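/- For every f ∈ D_V, lim_{N→∞} sup_{u∈Σ_N} |L_N f(u) − λ(f)(u)| = 0. -/

import Mathlib

open Finset

section ZRP

variable {V : Type*} [Fintype V] [DecidableEq V]

/-- Irreducibility of a set of transition rates. -/
def IrreducibleRates (r : V → V → ℝ) : Prop :=
  ∀ i j : V, i ≠ j → ∃ (m : ℕ) (k : ℕ → V), k 0 = i ∧ k m = j ∧ ∀ l < m, 0 < r (k l) (k (l + 1))

/-- `ind A j` plays the role of the vector `1^A_j`: it equals the indicator of `{j}` on `A`
and is harmonic (for the generator of `r`) at every point outside `A`. -/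
def IsHarmFamily (r : V → V → ℝ) (ind : Finset V → V → V → ℝ) : Prop :=
  ∀ (A : Finset V), ∀ j ∈ A,
    (∀ i ∈ A, ind A j i = if i = j then (1 : ℝ) else 0) ∧
    (∀ k, k ∉ A → ∑ l, r k l * (ind A j l - ind A j k) = 0)

/-- The trace rates `r^A(i,j) = r(i,j) + ∑_{k∉A} r(i,k)·1^A_j(k)` (for `i ≠ j`). -/
noncomputable def traceRate (r : V → V → ℝ) (ind : Finset V → V → V → ℝ)
    (A : Finset V) (i j : V) : ℝ :=
  if i = j then 0 else r i j + ∑ k ∈ Aᶜ, r i k * ind A j k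

/-- `λ^A(i) = ∑_{j∈A} (r^A(j,i) − r^A(i,j))`. -/
noncomputable def lamA (r : V → V → ℝ) (ind : Finset V → V → V → ℝ)
    (A : Finset V) (i : V) : ℝ :=
  ∑ j ∈ A, (traceRate r ind A j i - traceRate r ind A i j)

/-- `A` is `r`-absorbing if `A = V` or `λ^{A∪{j}}(j) ≤ 0` for every `j ∉ A`. -/
def IsAbsorbing (r : V → V → ℝ) (ind : Finset V → V → V → ℝ) (A : Finset V) : Prop :=
  A = Finset.univ ∨ ∀ j ∉ A, lamA r ind (insert j A) j ≤ 0

/-- The support `𝒮(u) = {i : u i > 0}`. -/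
noncomputable def suppF (u : V → ℝ) : Finset V :=
  open scoped Classical in Finset.univ.filter (fun i => 0 < u i)

/-- `𝒜(S)`: the intersection of all `r`-absorbing subsets of `V` containing `S`. -/
noncomputable def minAbs (r : V → V → ℝ) (ind : Finset V → V → V → ℝ) (S : Finset V) :
    Finset V :=
  open scoped Classical in
  Finset.univ.filter (fun i => ∀ A : Finset V, IsAbsorbing r ind A → S ⊆ A → i ∈ A)

/-- The vector `v_i = ∑_k r(i,k)(1_{k} − 1_{i})`. -/
noncomputable def vvec (r : V → V → ℝ) (i : V) : V → ℝ :=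
  fun l => ∑ k, r i k * ((if l = k then (1 : ℝ) else 0) - (if l = i then (1 : ℝ) else 0))

/-- The vector `λ(j) = ∑_i (r(i,j) − r(j,i))`. -/
noncomputable def lamV (r : V → V → ℝ) : V → ℝ := fun j => ∑ i, (r i j - r j i)

/-- Membership in `D_B`: `f` is `C¹` on an open set containing the simplex and
`⟨∇f(u), v_i⟩ = 0` whenever `u ∈ Σ`, `u i = 0`, for every `i ∈ B`. -/
def MemD (r : V → V → ℝ) (B : Finset V) (f : (V → ℝ) → ℝ) : Prop :=
  (∃ U : Set (V → ℝ), IsOpen U ∧ stdSimplex ℝ V ⊆ U ∧ ContDiffOn ℝ 1 f U) ∧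
  ∀ i ∈ B, ∀ u ∈ stdSimplex ℝ V, u i = 0 → fderiv ℝ f u (vvec r i) = 0

/-- Condition (A). -/
def CondA (r : V → V → ℝ) (ζ : ℝ → V → ℝ) : Prop :=
  ∀ f : (V → ℝ) → ℝ, MemD r Finset.univ f → ∀ t : ℝ, 0 ≤ t →
    f (ζ t) = f (ζ 0) + ∫ s in (0:ℝ)..t, fderiv ℝ f (ζ s) (lamV r)

/-- A continuous path in the simplex (for nonnegative times). -/
def IsPath (ζ : ℝ → V → ℝ) : Prop :=
  ContinuousOn ζ (Set.Ici 0) ∧ ∀ t : ℝ, 0 ≤ t → ζ t ∈ stdSimplex ℝ V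

/-- `Σ_abs`: the configurations whose support is `r`-absorbing. -/
def SigmaAbs (r : V → V → ℝ) (ind : Finset V → V → V → ℝ) : Set (V → ℝ) :=
  {u | u ∈ stdSimplex ℝ V ∧ IsAbsorbing r ind (suppF u)}

/-- Condition (B): `inf{t ≥ 0 : ζ_t ∈ Σ_abs} = 0`. -/
def CondB (r : V → V → ℝ) (ind : Finset V → V → V → ℝ) (ζ : ℝ → V → ℝ) : Prop :=
  ∀ ε : ℝ, 0 < ε → ∃ t : ℝ, 0 ≤ t ∧ t < ε ∧ ζ t ∈ SigmaAbs r ind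

end ZRP

/-- First-order Taylor expansion, uniform on a compact convex set. -/
theorem uniform_taylor_of_contDiffOn {E : Type*} [NormedAddCommGroup E] [NormedSpace ℝ E]
    {f : E → ℝ} {U K : Set E} (hU : IsOpen U) (hKU : K ⊆ U) (hK : IsCompact K)
    (hKc : Convex ℝ K) (hf : ContDiffOn ℝ 1 f U) {ε : ℝ} (hε : 0 < ε) :
    ∃ δ > 0, ∀ x ∈ K, ∀ y ∈ K, ‖y - x‖ < δ →
      |f y - f x - fderiv ℝ f x (y - x)| ≤ ε * ‖y - x‖ := by
  have huc : UniformContinuousOn (fderiv ℝ f) K :=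
    hK.uniformContinuousOn_of_continuous ((hf.continuousOn_fderiv_of_isOpen hU le_rfl).mono hKU)
  obtain ⟨δ, hδ, h⟩ := Metric.uniformContinuousOn_iff.1 huc ε hε
  refine ⟨δ, hδ, fun x hx y hy hxy => ?_⟩
  have hseg : segment ℝ x y ⊆ K := hKc.segment_subset hx hy
  have hderiv : ∀ z ∈ segment ℝ x y,
      HasFDerivWithinAt f (fderiv ℝ f z) (segment ℝ x y) z := fun z hz =>
    (((hf.differentiableOn one_ne_zero).differentiableAt
      (hU.mem_nhds (hKU (hseg hz)))).hasFDerivAt).hasFDerivWithinAt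
  refine (convex_segment x y).norm_image_sub_le_of_norm_hasFDerivWithin_le' hderiv
    (fun z hz => ?_) (left_mem_segment ℝ x y) (right_mem_segment ℝ x y)
  rw [← dist_eq_norm]
  refine (h z (hseg hz) x hx ?_).le
  rw [dist_eq_norm]
  exact (norm_sub_le_of_mem_segment hz).trans_lt hxy

theorem empirical_mem_stdSimplex {V : Type*} [Fintype V] {N : ℕ} (hN : N ≠ 0) {η : V → ℕ}
    (hη : ∑ i, η i = N) :
    (fun k => (η k : ℝ) / N) ∈ stdSimplex ℝ V := by
  refine ⟨fun k => by positivity, ?_⟩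
  rw [← Finset.sum_div, ← Nat.cast_sum, hη, div_self (by exact_mod_cast hN)]

section ZeroRange

variable {V : Type*} [Fintype V] [DecidableEq V]

theorem vvec_eq_sum_smul (r : V → V → ℝ) (i : V) :
    vvec r i = ∑ j, r i j •
      (fun k => (if k = j then (1 : ℝ) else 0) - (if k = i then (1 : ℝ) else 0)) := by
  ext l
  simp [vvec, Finset.sum_apply]

theorem lamV_eq_sum_vvec (r : V → V → ℝ) : lamV r = ∑ i, vvec r i := by
  ext l
  simp [lamV, vvec, Finset.sum_apply, mul_sub, Finset.sum_sub_distrib]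

theorem vvec_eq_zero_of_subsingleton (r : V → V → ℝ) (i : V) (h : ∀ j, j = i) :
    vvec r i = 0 := by
  ext l
  simp [vvec, h]

theorem norm_indicator_sub_le_one (i j : V) :
    ‖(fun k => (if k = j then (1 : ℝ) else 0) - (if k = i then (1 : ℝ) else 0))‖ ≤ 1 := by
  refine (pi_norm_le_iff_of_nonneg zero_le_one).2 fun k => ?_
  split_ifs <;> simp

/-- Moving mass `c ≤ u i` from `i` to `j` stays in the simplex. -/
theorem move_mem_stdSimplex {u : V → ℝ} (hu : u ∈ stdSimplex ℝ V) (i j : V) {c : ℝ}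
    (hc : 0 ≤ c) (hci : c ≤ u i) :
    u + c • (fun k => (if k = j then (1 : ℝ) else 0) - (if k = i then (1 : ℝ) else 0)) ∈
      stdSimplex ℝ V := by
  refine ⟨fun k => ?_, ?_⟩
  · have := hu.1 k
    simp only [Pi.add_apply, Pi.smul_apply, smul_eq_mul]
    split_ifs with h1 h2 h2 <;> first | (subst h2; linarith) | linarith
  · simp [Finset.sum_add_distrib, ← Finset.mul_sum, hu.2]

/-- For `f ∈ D_i` the derivative along `v_i` is uniformly small near the face `u i = 0`. -/
theorem exists_fderiv_vvec_le {r : V → V → ℝ} {f : (V → ℝ) → ℝ} {B : Finset V}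
    (hf : MemD r B f) {i : V} (hi : i ∈ B) {ε : ℝ} (hε : 0 < ε) :
    ∃ δ > 0, ∀ u ∈ stdSimplex ℝ V, u i < δ → |fderiv ℝ f u (vvec r i)| ≤ ε := by
  by_cases hsub : ∀ j, j = i
  · exact ⟨1, one_pos, fun u _ _ => by
      simpa [vvec_eq_zero_of_subsingleton r i hsub] using hε.le⟩
  push Not at hsub
  obtain ⟨j, hj⟩ := hsub
  obtain ⟨⟨U, hU, hKU, hfU⟩, hD⟩ := hf
  have hcont : ContinuousOn (fun u => fderiv ℝ f u (vvec r i)) (stdSimplex ℝ V) :=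
    ((hfU.continuousOn_fderiv_of_isOpen hU le_rfl).mono hKU).clm_apply continuousOn_const
  obtain ⟨δ, hδ, h⟩ := Metric.uniformContinuousOn_iff.1
    ((isCompact_stdSimplex ℝ V).uniformContinuousOn_of_continuous hcont) ε hε
  refine ⟨δ, hδ, fun u hu hui => ?_⟩
  set w : V → ℝ := fun k => (if k = j then (1 : ℝ) else 0) - (if k = i then (1 : ℝ) else 0)
  have hmem : u + u i • w ∈ stdSimplex ℝ V := move_mem_stdSimplex hu i j (hu.1 i) le_rfl
  have hzero := hD i hi _ hmem (by simp [w, hj.symm])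
  have hdist : dist u (u + u i • w) < δ := by
    rw [dist_self_add_right, norm_smul, Real.norm_of_nonneg (hu.1 i)]
    exact (mul_le_of_le_one_right (hu.1 i) (norm_indicator_sub_le_one i j)).trans_lt hui
  have := h u hu _ hmem hdist
  rw [hzero, Real.dist_eq, sub_zero] at this
  exact this.le

theorem eventually_rate_mul_fderiv_vvec_le {r : V → V → ℝ} {f : (V → ℝ) → ℝ} {B : Finset V}
    (hf : MemD r B f) {g : ℕ → ℝ} (hg : Filter.Tendsto g Filter.atTop (nhds 1))
    {i : V} (hi : i ∈ B) {ε : ℝ} (hε : 0 < ε) :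
    ∀ᶠ N : ℕ in Filter.atTop, ∀ η : V → ℕ, ∑ k, η k = N →
      |(g (η i) - 1) * fderiv ℝ f (fun k => (η k : ℝ) / N) (vvec r i)| ≤ ε := by
  have hcont : ContinuousOn (fun u => fderiv ℝ f u (vvec r i)) (stdSimplex ℝ V) := by
    obtain ⟨⟨U, hU, hKU, hfU⟩, -⟩ := hf
    exact ((hfU.continuousOn_fderiv_of_isOpen hU le_rfl).mono hKU).clm_apply continuousOn_const
  obtain ⟨C, hC⟩ := (isCompact_stdSimplex ℝ V).exists_bound_of_continuousOn hcont
  obtain ⟨G, hG⟩ := (hg.sub_const 1).norm.bddAbove_range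
  have hG' : ∀ n, |g n - 1| ≤ G := fun n => hG ⟨n, rfl⟩
  have hG0 : 0 ≤ G := (abs_nonneg _).trans (hG' 0)
  have hC1 : 0 < |C| + 1 := by positivity
  obtain ⟨M, hM⟩ := Metric.tendsto_atTop.1 hg (ε / (|C| + 1)) (by positivity)
  obtain ⟨δ, hδ, hsmall⟩ := exists_fderiv_vvec_le hf hi (ε := ε / (G + 1)) (by positivity)
  have hlim := (tendsto_const_div_atTop_nhds_zero_nat (M : ℝ)).eventually_lt_const hδ
  filter_upwards [hlim, Filter.eventually_ne_atTop 0] with N hMN hN η hη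
  have hu := empirical_mem_stdSimplex hN hη
  rw [abs_mul]
  rcases le_or_gt M (η i) with hle | hlt
  · have h1 : |g (η i) - 1| ≤ ε / (|C| + 1) := (hM _ hle).le
    have h2 := (hC _ hu).trans ((le_abs_self C).trans (lt_add_one |C|).le)
    calc _ ≤ ε / (|C| + 1) * (|C| + 1) := mul_le_mul h1 h2 (abs_nonneg _) (by positivity)
      _ = ε := by field_simp
  · have h2 := hsmall _ hu (lt_of_le_of_lt (by gcongr) hMN)
    calc _ ≤ (G + 1) * (ε / (G + 1)) :=
          mul_le_mul ((hG' _).trans (by linarith)) h2 (abs_nonneg _) (by positivity)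
      _ = ε := by field_simp

theorem eventually_rate_mul_jump_remainder_le {r : V → V → ℝ} {f : (V → ℝ) → ℝ} {B : Finset V}
    (hf : MemD r B f) {g : ℕ → ℝ} (hg0 : g 0 = 0)
    (hg : Filter.Tendsto g Filter.atTop (nhds 1)) {ε : ℝ} (hε : 0 < ε) :
    ∀ᶠ N : ℕ in Filter.atTop, ∀ η : V → ℕ, ∑ k, η k = N → ∀ i j,
      |g (η i) * (N * (f (fun k => (η k : ℝ) / N +
              ((if k = j then (1 : ℝ) else 0) - (if k = i then (1 : ℝ) else 0)) / N) -
            f (fun k => (η k : ℝ) / N)) -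
          fderiv ℝ f (fun k => (η k : ℝ) / N)
            (fun k => (if k = j then (1 : ℝ) else 0) - (if k = i then (1 : ℝ) else 0)))| ≤ ε := by
  obtain ⟨⟨U, hU, hKU, hfU⟩, -⟩ := hf
  obtain ⟨G, hG⟩ := hg.norm.bddAbove_range
  have hG' : ∀ n, |g n| ≤ G := fun n => hG ⟨n, rfl⟩
  have hG0 : 0 ≤ G := (abs_nonneg _).trans (hG' 0)
  obtain ⟨δ, hδ, htaylor⟩ := uniform_taylor_of_contDiffOn hU hKU (isCompact_stdSimplex ℝ V)
    (convex_stdSimplex ℝ V) hfU (ε := ε / (G + 1)) (by positivity)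
  have hlim := (tendsto_const_div_atTop_nhds_zero_nat (1 : ℝ)).eventually_lt_const hδ
  filter_upwards [hlim, Filter.eventually_ne_atTop 0] with N hNδ hN η hη i j
  rcases Nat.eq_zero_or_pos (η i) with h0 | hpos
  · simpa [h0, hg0] using hε.le
  have hNpos : (0 : ℝ) < N := by positivity
  have hu := empirical_mem_stdSimplex hN hη
  set u : V → ℝ := fun k => (η k : ℝ) / N with hu_def
  set w : V → ℝ := fun k => (if k = j then (1 : ℝ) else 0) - (if k = i then (1 : ℝ) else 0)
    with hw_def
  have hw : ‖w‖ ≤ 1 := norm_indicator_sub_le_one i j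
  have hjump : (fun k => (η k : ℝ) / N +
      ((if k = j then (1 : ℝ) else 0) - (if k = i then (1 : ℝ) else 0)) / N) =
      u + (1 / (N : ℝ)) • w := by
    ext k
    simp only [hu_def, hw_def, Pi.add_apply, Pi.smul_apply, smul_eq_mul]
    ring
  have hmem : u + (1 / (N : ℝ)) • w ∈ stdSimplex ℝ V := by
    refine move_mem_stdSimplex hu i j (by positivity) ?_
    have : (1 : ℝ) ≤ η i := by exact_mod_cast hpos
    simp only [hu_def]
    gcongr
  have hnorm : ‖(1 / (N : ℝ)) • w‖ ≤ 1 / N := by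
    rw [norm_smul, Real.norm_of_nonneg (by positivity)]
    exact mul_le_of_le_one_right (by positivity) hw
  have h := htaylor u hu _ hmem (by simpa only [add_sub_cancel_left] using hnorm.trans_lt hNδ)
  rw [add_sub_cancel_left, map_smul, smul_eq_mul] at h
  have hscale : N * (f (u + (1 / (N : ℝ)) • w) - f u) - fderiv ℝ f u w =
      N * (f (u + (1 / (N : ℝ)) • w) - f u - 1 / N * fderiv ℝ f u w) := by
    field_simp
  have hrem : |N * (f (u + (1 / (N : ℝ)) • w) - f u) - fderiv ℝ f u w| ≤ ε / (G + 1) := by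
    rw [hscale, abs_mul, abs_of_pos hNpos]
    calc _ ≤ (N : ℝ) * (ε / (G + 1) * (1 / N)) := by
          gcongr
          exact h.trans (by gcongr)
      _ = ε / (G + 1) := by field_simp
  rw [hjump, abs_mul]
  calc _ ≤ (G + 1) * (ε / (G + 1)) :=
        mul_le_mul ((hG' _).trans (by linarith)) hrem (abs_nonneg _) (by positivity)
    _ = ε := by field_simp

end ZeroRange

/-- for every `f ∈ D_V`, `sup_{u ∈ Σ_N} |L_N f(u) − λ(f)(u)| → 0` as `N → ∞`
(in `ε`–`N₀` form, with `Σ_N` parametrized by particle configurations `η` with `N` particles). -/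
theorem generator_convergence (V : Type*) [Fintype V] [DecidableEq V] [Nonempty V]
    (r : V → V → ℝ) (hr_nonneg : ∀ i j, 0 ≤ r i j) (hr_diag : ∀ i, r i i = 0)
    (hr_irr : IrreducibleRates r)
    (g : ℕ → ℝ) (hg0 : g 0 = 0) (hg : Filter.Tendsto g Filter.atTop (nhds 1))
    (f : (V → ℝ) → ℝ) (hf : MemD r Finset.univ f) :
    ∀ ε : ℝ, 0 < ε → ∃ N₀ : ℕ, ∀ N : ℕ, N₀ ≤ N → ∀ η : V → ℕ, ∑ i, η i = N →
      |(N : ℝ) * ∑ i, ∑ j, g (η i) * r i j *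
          (f (fun k => (η k : ℝ) / N +
              ((if k = j then (1 : ℝ) else 0) - (if k = i then (1 : ℝ) else 0)) / N) -
            f (fun k => (η k : ℝ) / N)) -
        fderiv ℝ f (fun k => (η k : ℝ) / N) (lamV r)| ≤ ε := by
  intro ε hε
  set R : ℝ := ∑ i, ∑ j, r i j
  have hR : 0 ≤ R := Finset.sum_nonneg fun i _ => Finset.sum_nonneg fun j _ => hr_nonneg i j
  have hcard : (0 : ℝ) < Fintype.card V := by exact_mod_cast Fintype.card_pos
  have hjump := eventually_rate_mul_jump_remainder_le hf hg0 hg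
    (ε := ε / (2 * (R + 1))) (by positivity)
  have hface := Filter.eventually_all.2 fun i => eventually_rate_mul_fderiv_vvec_le hf hg
    (Finset.mem_univ i) (ε := ε / (2 * Fintype.card V)) (by positivity)
  obtain ⟨N₀, hN₀⟩ := Filter.eventually_atTop.1 (hjump.and hface)
  refine ⟨N₀, fun N hN η hη => ?_⟩
  obtain ⟨h1, h2⟩ := hN₀ N hN
  replace h1 := h1 η hη
  replace h2 := fun i => h2 i η hη
  set D := fderiv ℝ f (fun k => (η k : ℝ) / N)
  set w : V → V → V → ℝ := fun i j k =>
    (if k = j then (1 : ℝ) else 0) - (if k = i then (1 : ℝ) else 0) with hw_def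
  set Δ : V → V → ℝ := fun i j => f (fun k => (η k : ℝ) / N +
    ((if k = j then (1 : ℝ) else 0) - (if k = i then (1 : ℝ) else 0)) / N) -
      f (fun k => (η k : ℝ) / N) with hΔ_def
  have hDv : ∀ i, D (vvec r i) = ∑ j, r i j * D (w i j) := fun i => by
    simp [vvec_eq_sum_smul, map_sum, hw_def]
  have hsplit : (N : ℝ) * ∑ i, ∑ j, g (η i) * r i j * Δ i j - D (lamV r) =
      ∑ i, ∑ j, r i j * (g (η i) * (N * Δ i j - D (w i j))) +
        ∑ i, (g (η i) - 1) * D (vvec r i) := by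
    rw [lamV_eq_sum_vvec, map_sum, Finset.mul_sum, ← Finset.sum_sub_distrib,
      ← Finset.sum_add_distrib]
    refine Finset.sum_congr rfl fun i _ => ?_
    have : ∑ j, r i j * (g (η i) * (N * Δ i j - D (w i j))) =
        N * ∑ j, g (η i) * r i j * Δ i j - g (η i) * D (vvec r i) := by
      rw [hDv, Finset.mul_sum, Finset.mul_sum, ← Finset.sum_sub_distrib]
      exact Finset.sum_congr rfl fun j _ => by ring
    rw [this]
    ring
  have hA : |∑ i, ∑ j, r i j * (g (η i) * (N * Δ i j - D (w i j)))| ≤ ε / 2 := by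
    calc _ ≤ ∑ i, ∑ j, r i j * (ε / (2 * (R + 1))) := by
          refine (Finset.abs_sum_le_sum_abs _ _).trans (Finset.sum_le_sum fun i _ => ?_)
          refine (Finset.abs_sum_le_sum_abs _ _).trans (Finset.sum_le_sum fun j _ => ?_)
          rw [abs_mul, abs_of_nonneg (hr_nonneg i j)]
          exact mul_le_mul_of_nonneg_left (h1 i j) (hr_nonneg i j)
      _ = R * (ε / (2 * (R + 1))) := by simp only [R, Finset.sum_mul]
      _ ≤ (R + 1) * (ε / (2 * (R + 1))) := by gcongr; linarith
      _ = ε / 2 := by field_simp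
  have hB : |∑ i, (g (η i) - 1) * D (vvec r i)| ≤ ε / 2 := by
    calc _ ≤ ∑ _i : V, ε / (2 * Fintype.card V) :=
          (Finset.abs_sum_le_sum_abs _ _).trans (Finset.sum_le_sum fun i _ => h2 i)
      _ = ε / 2 := by
          rw [Finset.sum_const, Finset.card_univ, nsmul_eq_mul]
          field_simp
  rw [hsplit]
  exact (abs_add_le _ _).trans (by linarith)
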